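/- The reduction from Partition to (1|pMA|Σ C_i) is correct: there exists a subset X_1 ⊆ {1,…,n} with Σ_{i∈X_1} x_i = B if and only if there exists a permutation π of the 2n+3 jobs of instance I whose total completion time satisfies F(π) ≤ Q0 + B. -/

import Mathlib

/-- Completion time of the `i`-th scheduled job (0-based) in the normalized form:
`C_i(π) = Σ_{j ≤ i} p_{π_j} + max(0, Σ_{j ≤ i} δ_{π_j} - ML0)`. -/
def complTime (N : ℕ) (p δ : ℕ → ℤ) (ML0 : ℤ) (π : Equiv.Perm (Fin N)) (i : Fin N) : ℤ :=
  (∑ j ∈ Finset.Iic i, p ((π j : ℕ))) + max 0 ((∑ j ∈ Finset.Iic i, δ ((π j : ℕ))) - ML0)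

/-- Total completion time `F(π) = Σ_i C_i(π)`. -/
def totalCompl (N : ℕ) (p δ : ℕ → ℤ) (ML0 : ℤ) (π : Equiv.Perm (Fin N)) : ℤ :=
  ∑ i : Fin N, complTime N p δ ML0 π i

open Finset in
theorem mul_succ_le_two_mul_sum (f : ℕ → ℤ) (h0 : f 0 = 0) (hnn : ∀ i, 0 ≤ f i)
    (hs : ∀ i, f (i + 1) ≤ f i + 1) (K : ℕ) :
    f K * (f K + 1) ≤ 2 * ∑ i ∈ range K, f (i + 1) := by
  induction K with
  | zero => simp [h0]
  | succ K ih =>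
    rw [sum_range_succ]
    rcases (hnn (K + 1)).eq_or_lt with h | h
    · rw [← h]
      nlinarith [hnn K]
    · nlinarith [hnn K, hs K]

open Finset in
theorem mul_pred_le_two_mul_sum (f : ℕ → ℤ) (K : ℕ) (hnn : ∀ i ≤ K, 0 ≤ f i)
    (hs : ∀ i, f i ≤ f (i + 1) + 1) :
    f 0 * (f 0 - 1) ≤ 2 * ∑ i ∈ range K, f (i + 1) + f K * (f K - 1) := by
  induction K with
  | zero => simp
  | succ K ih =>
    have := ih fun i hi => hnn i (by omega)
    rw [sum_range_succ]
    have h1 := hnn K (by omega)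
    have h2 := hnn (K + 1) le_rfl
    have : f K * (f K - 1) ≤ f (K + 1) * (f (K + 1) + 1) := by
      rcases h1.eq_or_lt with h | h
      · rw [← h]
        nlinarith
      · nlinarith [hs K]
    linarith

/-- The convexity estimate for the number `N k` of marked jobs among the first `k` of `2 * K`. -/
theorem card_prefix_convexity (e : ℕ → ℤ) (he0 : ∀ a, 0 ≤ e a) (he1 : ∀ a, e a ≤ 1) (K : ℕ)
    (N : ℕ → ℤ) (hN : ∀ k, N k = ∑ a ∈ Finset.range k, e a) (c d : ℤ)
    (hc : N (2 * K) = 2 * c) (hd : N K = c + d) :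
    c ^ 2 + d ^ 2 + d ≤ ∑ k ∈ Finset.range K, N (k + 1)
      + ∑ k ∈ Finset.range K, (2 * c - N (K + k + 1)) := by
  have hstep : ∀ k, N (k + 1) = N k + e k := fun k => by
    rw [hN, hN, Finset.sum_range_succ]
  have hmono : Monotone N := monotone_nat_of_le_succ fun k => by linarith [hstep k, he0 k]
  have hN0 : N 0 = 0 := by simp [hN]
  have h1 := mul_succ_le_two_mul_sum N hN0 (fun i => hN0 ▸ hmono (Nat.zero_le i))
    (fun i => by linarith [hstep i, he1 i]) K
  have h2 := mul_pred_le_two_mul_sum (fun i => 2 * c - N (K + i)) K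
    (fun i hi => by linarith [hmono (show K + i ≤ 2 * K by omega)])
    (fun i => by
      have := hstep (K + i)
      rw [← Nat.add_assoc]
      linarith [he1 (K + i)])
  simp only [← Nat.add_assoc, Nat.add_zero, ← two_mul, hc, hd] at h1 h2
  nlinarith

/-- The sequence of jobs scheduled by `π` once the one in position `m` is deleted. -/
def restOrder {N : ℕ} (π : Equiv.Perm (Fin (N + 1))) (m : Fin (N + 1)) (a : ℕ) : ℕ :=
  if h : a < N then (π (m.succAbove ⟨a, h⟩) : ℕ) else 0

open Finset in
theorem sum_Iic_perm {N : ℕ} (π : Equiv.Perm (Fin (N + 1))) (m : Fin (N + 1)) (f : ℕ → ℤ)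
    (i : Fin (N + 1)) (k : ℕ) (hk : k ≤ N)
    (hi : ∀ b : Fin N, m.succAbove b ≤ i ↔ (b : ℕ) < k) :
    ∑ j ∈ Iic i, f (π j) =
      (if m ≤ i then f (π m) else 0) + ∑ a ∈ range k, f (restOrder π m a) := by
  have h1 : ∑ j ∈ Iic i, f (π j) = ∑ j, if j ≤ i then f (π j) else 0 := by
    rw [← sum_filter]
    congr 1
    ext j
    simp
  rw [h1, Fin.sum_univ_succAbove _ m]
  congr 1
  have h2 : range k = (range N).filter (· < k) := by
    ext a
    simp
    omega
  rw [h2, sum_filter, ← Fin.sum_univ_eq_sum_range (fun a => if a < k then f (restOrder π m a) else 0)]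
  refine sum_congr rfl fun b _ => ?_
  simp [hi, restOrder]

open Finset in
/-- Deleting a job that consumes no maintenance level. -/
theorem totalCompl_eq {N : ℕ} (p δ : ℕ → ℤ) (ML0 : ℤ) (π : Equiv.Perm (Fin (N + 1)))
    (m : Fin (N + 1)) (hm : δ (π m) = 0) (c : ℕ → ℤ)
    (hc : ∀ k ≤ N, c k = ∑ a ∈ range k, p (restOrder π m a)
      + max 0 (∑ a ∈ range k, δ (restOrder π m a) - ML0)) :
    totalCompl (N + 1) p δ ML0 π =
      ∑ k ∈ range N, c (k + 1) + c m + (N + 1 - (m : ℕ)) * p (π m) := by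
  have hmN : (m : ℕ) ≤ N := by omega
  have hCm : complTime (N + 1) p δ ML0 π m = p (π m) + c m := by
    have hlt : ∀ b : Fin N, m.succAbove b ≤ m ↔ (b : ℕ) < m := fun b => by
      rw [Fin.succAbove]
      split_ifs with h <;>
        (simp only [Fin.le_def, Fin.lt_def, Fin.val_castSucc, Fin.val_succ] at h ⊢; omega)
    rw [complTime, sum_Iic_perm π m p m m hmN hlt, sum_Iic_perm π m δ m m hmN hlt, hc m hmN]
    simp [hm, add_assoc]
  have hCa : ∀ a : Fin N, complTime (N + 1) p δ ML0 π (m.succAbove a) =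
      (if (m : ℕ) ≤ a then p (π m) else 0) + c (a + 1) := fun a => by
    have hlt : ∀ b : Fin N, m.succAbove b ≤ m.succAbove a ↔ (b : ℕ) < a + 1 := fun b => by
      rw [(Fin.strictMono_succAbove m).le_iff_le, Fin.le_def]
      omega
    have hle : m ≤ m.succAbove a ↔ (m : ℕ) ≤ a := by
      rw [Fin.succAbove]
      split_ifs with h
      · simp only [Fin.le_def, Fin.val_castSucc]
      · simp only [Fin.le_def, Fin.lt_def, Fin.val_castSucc, Fin.val_succ] at h ⊢
        omega
    rw [complTime, sum_Iic_perm π m p _ (a + 1) (by omega) hlt,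
      sum_Iic_perm π m δ _ (a + 1) (by omega) hlt, hc _ (by omega)]
    simp [hm, hle, add_assoc]
  have hcount : ∑ a ∈ range N, (if (m : ℕ) ≤ a then p (π m) else 0) =
      (N - (m : ℕ)) * p (π m) := by
    rw [← sum_filter, show (range N).filter (fun a => (m : ℕ) ≤ a) = Ico (m : ℕ) N by
      ext a
      simp [and_comm]]
    simp [Nat.cast_sub hmN]
  rw [totalCompl, Fin.sum_univ_succAbove _ m, hCm, sum_congr rfl fun a _ => hCa a,
    Fin.sum_univ_eq_sum_range (fun a => (if (m : ℕ) ≤ a then p (π m) else 0) + c (a + 1)),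
    sum_add_distrib, hcount]
  ring

theorem sum_restOrder {N : ℕ} (π : Equiv.Perm (Fin (N + 1))) (m : Fin (N + 1))
    (hm : (π m : ℕ) = N) (g : ℕ → ℤ) :
    ∑ a ∈ Finset.range N, g (restOrder π m a) = ∑ b ∈ Finset.range N, g b := by
  have h1 := Equiv.sum_comp π (fun i => g i)
  rw [Fin.sum_univ_succAbove _ m, hm, Fin.sum_univ_castSucc (fun i : Fin (N + 1) => g i)] at h1
  simp only [Fin.val_last, Fin.val_castSucc] at h1
  rw [← Fin.sum_univ_eq_sum_range, ← Fin.sum_univ_eq_sum_range]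
  simp only [restOrder, Fin.is_lt, dite_true, Fin.eta]
  linarith

theorem restOrder_lt {N : ℕ} (hN : 0 < N) (π : Equiv.Perm (Fin (N + 1))) (m : Fin (N + 1))
    (hm : (π m : ℕ) = N) (a : ℕ) : restOrder π m a < N := by
  unfold restOrder
  split_ifs with h
  · have h1 : π (m.succAbove ⟨a, h⟩) ≠ π m := fun h => Fin.succAbove_ne m _ (π.injective h)
    have h2 : (π (m.succAbove ⟨a, h⟩) : ℕ) ≠ N := fun h => h1 (Fin.ext (h.trans hm.symm))
    omega
  · exact hN

theorem Int.mul_pred_nonneg (a : ℤ) : 0 ≤ a * (a - 1) := by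
  rcases le_or_gt a 0 with h | h <;> nlinarith

theorem sum_range_ite_le (j m : ℕ) (h : j ≤ m) :
    ∑ i ∈ Finset.range m, (if j ≤ i then (1 : ℤ) else 0) = m - j := by
  induction m, h using Nat.le_induction with
  | base =>
    rw [Finset.sum_eq_zero fun i hi => if_neg (by simpa using hi)]
    simp
  | succ m h ih =>
    rw [Finset.sum_range_succ, ih, if_pos h]
    push_cast
    ring

theorem sum_range_odd_mul_ite_le (j m : ℕ) (h : j ≤ m) :
    ∑ i ∈ Finset.range m, (2 * ((m : ℤ) - 1 - i) + 1) * (if j ≤ i then (1 : ℤ) else 0)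
      = (m - j) ^ 2 := by
  induction m, h using Nat.le_induction with
  | base =>
    rw [Finset.sum_eq_zero fun i hi => by rw [if_neg (by simpa using hi), mul_zero]]
    simp
  | succ m h ih =>
    have h1 : ∀ i ∈ Finset.range m,
        (2 * (((m + 1 : ℕ) : ℤ) - 1 - i) + 1) * (if j ≤ i then (1 : ℤ) else 0) =
        (2 * ((m : ℤ) - 1 - i) + 1) * (if j ≤ i then (1 : ℤ) else 0)
          + 2 * (if j ≤ i then (1 : ℤ) else 0) := fun i _ => by
      push_cast
      ring
    rw [Finset.sum_range_succ, Finset.sum_congr rfl h1, Finset.sum_add_distrib, ih,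
      ← Finset.mul_sum, sum_range_ite_le j m h, if_pos h]
    push_cast
    ring

theorem sum_Icc_eq_sum_mul_ite (n : ℕ) (x : ℕ → ℤ) (i : ℕ) (hi : i ≤ n) :
    ∑ j ∈ Finset.Icc 1 i, x j = ∑ j ∈ Finset.Icc 1 n, x j * (if j ≤ i then 1 else 0) := by
  simp only [mul_ite, mul_one, mul_zero]
  rw [← Finset.sum_filter]
  congr 1
  ext j
  simp
  omega

/-- Summation by parts for sums of prefix sums. -/
theorem sum_mul_sum_mul_ite (n : ℕ) (x : ℕ → ℤ) (s : Finset ℕ) (f : ℕ → ℤ) (t : ℕ → ℕ) :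
    ∑ i ∈ s, f i * ∑ j ∈ Finset.Icc 1 n, x j * (if j ≤ t i then 1 else 0) =
      ∑ j ∈ Finset.Icc 1 n, x j * ∑ i ∈ s, f i * (if j ≤ t i then 1 else 0) := by
  simp only [Finset.mul_sum]
  rw [Finset.sum_comm]
  refine Finset.sum_congr rfl fun j _ => Finset.sum_congr rfl fun i _ => ?_
  ring

theorem sum_range_succ_mul_two {n : ℕ} (g : ℕ → ℤ) :
    ∑ b ∈ Finset.range (2 * n + 2), g b =
      ∑ i ∈ Finset.range (n + 1), g i + ∑ i ∈ Finset.range (n + 1), g (n + 1 + i) := by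
  rw [show 2 * n + 2 = n + 1 + (n + 1) by ring, Finset.sum_range_add]

/-- The cost of scheduling the long job after `m` other jobs, compared with scheduling it
after `n + 1` of them. -/
theorem long_job_cost_le (n : ℕ) (B M S ML0 : ℤ) (hB0 : 0 ≤ B)
    (hM : (4 * (n : ℤ) + 8) * B < M) (hSB : S ≤ (n + 1) * (2 * B))
    (hML0 : ML0 = (n + 1) * M - 2 * S - 2 * B) (P c : ℕ → ℤ) (hP0 : P 0 = 0)
    (hPnn : ∀ k, 0 ≤ P k) (hPB : ∀ k t : ℕ, P (k + t) ≤ P k + t * (2 * B))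
    (hc : ∀ k, c k = P k + max 0 (k * M - 2 * P k - ML0)) (m : ℕ) :
    P (n + 1) + max 0 (2 * S + 2 * B - 2 * P (n + 1)) + (n + 2) * (M - 2 * B)
      - 2 * max 0 (P (n + 1) - S - B) ≤ c m + (2 * n + 3 - m) * (M - 2 * B) := by
  rcases lt_trichotomy m (n + 1) with h | h | h
  · obtain ⟨t, rfl⟩ : ∃ t, n = m + t := ⟨n - m, by omega⟩
    have h1 : 0 ≤ c m := by
      rw [hc]
      exact add_nonneg (hPnn m) (le_max_left _ _)
    have h2 := hPB 0 (m + t + 1)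
    rw [hP0, Nat.zero_add] at h2
    have h3 := hPnn (m + t + 1)
    have hmB := mul_nonneg (Int.natCast_nonneg m) hB0
    have htB := mul_nonneg (Int.natCast_nonneg t) hB0
    have h4 : P (m + t + 1) + max 0 (2 * S + 2 * B - 2 * P (m + t + 1)) ≤ M - 2 * B := by
      push_cast at *
      rcases max_cases 0 (2 * S + 2 * B - 2 * P (m + t + 1)) with h | h <;> linarith
    have h5 := le_max_left 0 (P (m + t + 1) - S - B)
    have h6 := le_max_left 0 (2 * S + 2 * B - 2 * P (m + t + 1))
    have h7 : 0 ≤ (t : ℤ) * (M - 2 * B) := mul_nonneg (Int.natCast_nonneg t) (by linarith)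
    push_cast
    linarith
  · subst h
    rw [hc, hML0]
    have h5 := le_max_left 0 (P (n + 1) - S - B)
    push_cast
    ring_nf at h5 ⊢
    linarith
  · obtain ⟨t, rfl⟩ : ∃ t, m = n + 1 + t := ⟨m - (n + 1), by omega⟩
    have h1 := hPB (n + 1) t
    have h2 : (t : ℤ) * M - P (n + 1 + t) + 2 * S + 2 * B ≤ c (n + 1 + t) := by
      rw [hc, hML0]
      refine le_trans (le_of_eq ?_) (add_le_add_right (le_max_right _ _) _)
      push_cast
      ring
    push_cast
    rcases max_cases 0 (2 * S + 2 * B - 2 * P (n + 1)) with h | h <;>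
      rcases max_cases 0 (P (n + 1) - S - B) with h' | h' <;> linarith

open Finset in
theorem sum_prefix_sum (n : ℕ) (x p : ℕ → ℤ)
    (hp : ∀ i ≤ n, p i = ∑ j ∈ Icc 1 i, x j) :
    ∑ i ∈ range (n + 1), p i = ∑ j ∈ Icc 1 n, x j * ((n : ℤ) + 1 - j) := by
  have h := sum_mul_sum_mul_ite n x (range (n + 1)) (fun _ => 1) id
  simp only [one_mul, id] at h
  rw [sum_congr rfl fun i hi => (hp i (by rw [mem_range] at hi; omega)).trans
    (sum_Icc_eq_sum_mul_ite n x i (by rw [mem_range] at hi; omega)), h]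
  refine sum_congr rfl fun j hj => ?_
  rw [mem_Icc] at hj
  rw [sum_range_ite_le j (n + 1) (by omega)]
  push_cast
  rfl

open Finset in
theorem sum_odd_mul_prefix_sum (n : ℕ) (x p : ℕ → ℤ)
    (hp : ∀ i ≤ n, p i = ∑ j ∈ Icc 1 i, x j) :
    ∑ j ∈ range (n + 1), (2 * ((n : ℤ) - j) + 1) * p j =
      ∑ j ∈ Icc 1 n, x j * ((n : ℤ) + 1 - j) ^ 2 := by
  have h := sum_mul_sum_mul_ite n x (range (n + 1)) (fun i => 2 * ((n : ℤ) - i) + 1) id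
  simp only [id] at h
  rw [sum_congr rfl fun i hi => by
    rw [hp i (by rw [mem_range] at hi; omega),
      sum_Icc_eq_sum_mul_ite n x i (by rw [mem_range] at hi; omega)], h]
  refine sum_congr rfl fun j hj => ?_
  rw [mem_Icc] at hj
  have := sum_range_odd_mul_ite_le j (n + 1) (by omega)
  push_cast at this
  rw [← this]
  simp

open Finset in
theorem jobs_cost_ge (n : ℕ) (B M S ML0 : ℤ)
    (hML0 : ML0 = (n + 1) * M - 2 * S - 2 * B) (P c : ℕ → ℤ)
    (hc : ∀ k, c k = P k + max 0 (k * M - 2 * P k - ML0)) :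
    ∑ k ∈ range (n + 1), P (k + 1)
      + ∑ k ∈ range (n + 1), (2 * S - P (n + 1 + k + 1))
      + M * ∑ j ∈ range (n + 1), ((j : ℤ) + 1) + 2 * B * (n + 1)
      + max 0 (2 * S + 2 * B - 2 * P (n + 1)) ≤ ∑ k ∈ range (2 * n + 2), c (k + 1) := by
  rw [sum_range_succ_mul_two, sum_range_succ (fun k => P (k + 1)) n,
    sum_range_succ (fun k => c (k + 1)) n]
  have h1 : ∑ k ∈ range n, P (k + 1) ≤ ∑ k ∈ range n, c (k + 1) :=
    sum_le_sum fun k _ => by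
      rw [hc]
      linarith [le_max_left 0 (((k + 1 : ℕ) : ℤ) * M - 2 * P (k + 1) - ML0)]
  have h2 : c (n + 1) = P (n + 1) + max 0 (2 * S + 2 * B - 2 * P (n + 1)) := by
    rw [hc, hML0]
    push_cast
    ring_nf
  have h3 : ∑ k ∈ range (n + 1), (2 * S - P (n + 1 + k + 1))
      + M * ∑ j ∈ range (n + 1), ((j : ℤ) + 1) + 2 * B * (n + 1)
      ≤ ∑ k ∈ range (n + 1), c (n + 1 + k + 1) := by
    have : 2 * B * ((n : ℤ) + 1) = ∑ k ∈ range (n + 1), 2 * B := by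
      simp
      ring
    rw [this, mul_sum, ← sum_add_distrib, ← sum_add_distrib]
    refine sum_le_sum fun k _ => ?_
    rw [hc, hML0]
    refine le_trans (le_of_eq ?_) (add_le_add_right (le_max_right _ _) _)
    push_cast
    ring
  linarith

theorem prefix_sum_bounds {n : ℕ} {x p : ℕ → ℤ} {B : ℤ} (hx : ∀ i, 1 ≤ i → i ≤ n → 0 < x i)
    (hB : ∑ i ∈ Finset.Icc 1 n, x i = 2 * B) (hp : ∀ i ≤ n, p i = ∑ j ∈ Finset.Icc 1 i, x j)
    (hp' : ∀ i ≤ n, p (n + 1 + i) = p i) {b : ℕ} (hb : b < 2 * n + 2) :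
    0 ≤ p b ∧ p b ≤ 2 * B := by
  have hxnn : ∀ j ∈ Finset.Icc 1 n, 0 ≤ x j := fun j hj => by
    rw [Finset.mem_Icc] at hj
    exact (hx j hj.1 hj.2).le
  have hle : ∀ i ≤ n, 0 ≤ p i ∧ p i ≤ 2 * B := fun i hi => by
    have hsub := Finset.Icc_subset_Icc_right (a := 1) hi
    rw [hp i hi, ← hB]
    exact ⟨Finset.sum_nonneg fun j hj => hxnn j (hsub hj),
      Finset.sum_le_sum_of_subset_of_nonneg hsub fun j hj _ => hxnn j hj⟩
  by_cases h : b ≤ n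
  · exact hle b h
  · obtain ⟨i, rfl⟩ : ∃ i, b = n + 1 + i := ⟨b - (n + 1), by omega⟩
    rw [hp' i (by omega)]
    exact hle i (by omega)

theorem sum_prefix_sum_le {n : ℕ} {p : ℕ → ℤ} {B : ℤ} (h : ∀ b < 2 * n + 2, p b ≤ 2 * B) :
    ∑ i ∈ Finset.range (n + 1), p i ≤ (n + 1) * (2 * B) := by
  have := Finset.sum_le_card_nsmul (Finset.range (n + 1)) p (2 * B) fun b hb => h b (by
    rw [Finset.mem_range] at hb
    omega)
  simpa using this

open Finset in
theorem exists_subset_of_cost_le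
    (n : ℕ) (x : ℕ → ℤ) (B M : ℤ)
    (hx : ∀ i, 1 ≤ i → i ≤ n → 0 < x i)
    (hB : ∑ i ∈ Icc 1 n, x i = 2 * B)
    (hM : (4 * (n : ℤ) + 8) * B < M)
    (p : ℕ → ℤ)
    (hp : ∀ i ≤ n, p i = ∑ j ∈ Icc 1 i, x j)
    (hp' : ∀ i ≤ n, p (n + 1 + i) = p i)
    (S ML0 : ℤ) (hS : S = ∑ i ∈ range (n + 1), p i)
    (hML0 : ML0 = (n + 1) * M - 2 * S - 2 * B)
    (Q0 : ℤ)
    (hQ0 : Q0 = ∑ j ∈ range (n + 1), (2 * ((n : ℤ) - j) + 1) * p j + S + (n + 2) * M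
      + M * ∑ j ∈ range (n + 1), ((j : ℤ) + 1))
    (ρ : ℕ → ℕ) (hρ : ∀ a, ρ a < 2 * n + 2)
    (hsum : ∀ g : ℕ → ℤ, ∑ a ∈ range (2 * n + 2), g (ρ a) = ∑ b ∈ range (2 * n + 2), g b)
    (P c : ℕ → ℤ) (hP : ∀ k, P k = ∑ a ∈ range k, p (ρ a))
    (hc : ∀ k, c k = P k + max 0 (k * M - 2 * P k - ML0))
    (m : ℕ)
    (hF : ∑ k ∈ range (2 * n + 2), c (k + 1) + c m + (2 * n + 3 - m) * (M - 2 * B) ≤ Q0 + B) :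
    ∃ X₁ : Finset ℕ, X₁ ⊆ Icc 1 n ∧ ∑ i ∈ X₁, x i = B := by
  let τ : ℕ → ℕ := fun b => if b ≤ n then b else b - (n + 1)
  have hτ1 : ∀ i ∈ range (n + 1), τ i = i := fun i hi => if_pos (by simpa [Nat.lt_succ_iff] using hi)
  have hτ2 : ∀ i ∈ range (n + 1), τ (n + 1 + i) = i := fun i _ => by
    simp only [τ]
    split_ifs <;> omega
  have hxnn : ∀ j ∈ Icc 1 n, 0 ≤ x j := fun j hj => by
    rw [mem_Icc] at hj
    exact (hx j hj.1 hj.2).le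
  have hpτ : ∀ b < 2 * n + 2,
      p b = ∑ j ∈ Icc 1 n, x j * (if j ≤ τ b then 1 else 0) := fun b hb => by
    by_cases h : b ≤ n
    · simp only [τ, if_pos h]
      rw [hp b h, sum_Icc_eq_sum_mul_ite n x b h]
    · obtain ⟨i, rfl⟩ : ∃ i, b = n + 1 + i := ⟨b - (n + 1), by omega⟩
      rw [hp' i (by omega), hp i (by omega), hτ2 i (by simp; omega),
        sum_Icc_eq_sum_mul_ite n x i (by omega)]
  have hB0 : 0 ≤ B := by
    have := sum_nonneg hxnn
    omega
  have hpnn : ∀ b < 2 * n + 2, 0 ≤ p b := fun b hb => (prefix_sum_bounds hx hB hp hp' hb).1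
  have hpB : ∀ b < 2 * n + 2, p b ≤ 2 * B := fun b hb => (prefix_sum_bounds hx hB hp hp' hb).2
  have hstep : ∀ k, P (k + 1) = P k + p (ρ k) := fun k => by rw [hP, hP, sum_range_succ]
  have hP0 : P 0 = 0 := by simp [hP]
  have hPB : ∀ k t, P (k + t) ≤ P k + t * (2 * B) := fun k t => by
    induction t with
    | zero => simp
    | succ t ih =>
      rw [← add_assoc, hstep]
      push_cast
      linarith [hpB _ (hρ (k + t))]
  have hPnn : ∀ k, 0 ≤ P k := fun k => by
    rw [hP]
    exact sum_nonneg fun a _ => hpnn _ (hρ a)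
  have hSB : S ≤ (n + 1) * (2 * B) := hS ▸ sum_prefix_sum_le hpB
  have hSsum := hS.trans (sum_prefix_sum n x p hp)
  have hWsum := sum_odd_mul_prefix_sum n x p hp
  let e : ℕ → ℕ → ℤ := fun j a => if j ≤ τ (ρ a) then 1 else 0
  let N : ℕ → ℕ → ℤ := fun j k => ∑ a ∈ range k, e j a
  have hPN : ∀ k, P k = ∑ j ∈ Icc 1 n, x j * N j k := fun k => by
    have h := sum_mul_sum_mul_ite n x (range k) (fun _ => 1) (fun a => τ (ρ a))
    simp only [one_mul] at h
    rw [hP, sum_congr rfl fun a _ => hpτ _ (hρ a), h]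
  have hNtot : ∀ j ∈ Icc 1 n, N j (2 * (n + 1)) = 2 * ((n : ℤ) + 1 - j) := fun j hj => by
    rw [mem_Icc] at hj
    have h := hsum fun b => if j ≤ τ b then 1 else 0
    have h1 := sum_range_ite_le j (n + 1) (by omega)
    have h2 : ∑ b ∈ range (2 * n + 2), (if j ≤ τ b then (1 : ℤ) else 0) =
        2 * ((n + 1 : ℕ) - j) := by
      rw [sum_range_succ_mul_two, two_mul, ← h1]
      exact congrArg₂ _ (sum_congr rfl fun i hi => by rw [hτ1 i hi])
        (sum_congr rfl fun i hi => by rw [hτ2 i hi])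
    simp only [N, e]
    rw [show 2 * (n + 1) = 2 * n + 2 by ring, h, h2]
    push_cast
    ring
  let d : ℕ → ℤ := fun j => N j (n + 1) - ((n : ℤ) + 1 - j)
  have hD : P (n + 1) - S = ∑ j ∈ Icc 1 n, x j * d j := by
    rw [hPN, hSsum, ← sum_sub_distrib]
    exact sum_congr rfl fun j _ => (mul_sub _ _ _).symm
  have hP2S : 2 * S = ∑ j ∈ Icc 1 n, x j * (2 * ((n : ℤ) + 1 - j)) := by
    rw [hSsum, mul_sum]
    exact sum_congr rfl fun j _ => by ring
  have hconv : ∑ j ∈ Icc 1 n, x j * (((n : ℤ) + 1 - j) ^ 2 + d j ^ 2 + d j) ≤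
      ∑ k ∈ range (n + 1), P (k + 1) + ∑ k ∈ range (n + 1), (2 * S - P (n + 1 + k + 1)) := by
    have h1 : ∑ k ∈ range (n + 1), P (k + 1) + ∑ k ∈ range (n + 1), (2 * S - P (n + 1 + k + 1))
        = ∑ j ∈ Icc 1 n, x j * (∑ k ∈ range (n + 1), N j (k + 1)
          + ∑ k ∈ range (n + 1), (2 * ((n : ℤ) + 1 - j) - N j (n + 1 + k + 1))) := by
      rw [hP2S]
      simp only [hPN, ← sum_sub_distrib, ← mul_sub]
      rw [sum_comm, sum_comm (s := range (n + 1)), ← sum_add_distrib]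
      simp only [← mul_sum, ← mul_add]
    rw [h1]
    refine sum_le_sum fun j hj => mul_le_mul_of_nonneg_left ?_ (hxnn j hj)
    refine card_prefix_convexity (e j) (fun a => ?_) (fun a => ?_) (n + 1) (N j) (fun _ => rfl) _ _
      (hNtot j hj) (by simp only [d]; ring)
    all_goals
      simp only [e]
      split_ifs <;> simp
  have hcsum := jobs_cost_ge n B M S ML0 hML0 P c hc
  have hlong := long_job_cost_le n B M S ML0 hB0 hM hSB hML0 P c hP0 hPnn hPB hc m
  have hsplit : ∑ j ∈ Icc 1 n, x j * (((n : ℤ) + 1 - j) ^ 2 + d j ^ 2 + d j) =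
      ∑ j ∈ range (n + 1), (2 * ((n : ℤ) - j) + 1) * p j
        + ∑ j ∈ Icc 1 n, x j * (d j * (d j - 1)) + 2 * (P (n + 1) - S) := by
    rw [hWsum, hD, mul_sum, ← sum_add_distrib, ← sum_add_distrib]
    exact sum_congr rfl fun j _ => by ring
  have hterm : ∀ j ∈ Icc 1 n, 0 ≤ x j * (d j * (d j - 1)) := fun j hj =>
    mul_nonneg (hxnn j hj) (Int.mul_pred_nonneg (d j))
  have hR := sum_nonneg hterm
  have hkey : ∑ j ∈ Icc 1 n, x j * (d j * (d j - 1)) = 0 ∧ P (n + 1) - S = B := by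
    rcases max_cases 0 (2 * S + 2 * B - 2 * P (n + 1)) with h | h <;>
      rcases max_cases 0 (P (n + 1) - S - B) with h' | h' <;> constructor <;> linarith
  refine ⟨(Icc 1 n).filter (fun j => d j = 1), filter_subset _ _, ?_⟩
  rw [sum_filter, ← hkey.2, hD]
  refine sum_congr rfl fun j hj => ?_
  have h1 := (sum_eq_zero_iff_of_nonneg hterm).1 hkey.1 j hj
  rw [mem_Icc] at hj
  split_ifs with h
  · rw [h, mul_one]
  · have h2 : d j = 0 := by simpa [(hx j hj.1 hj.2).ne', sub_eq_zero, h] using h1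
    rw [h2, mul_zero]

open Finset in
theorem sum_range_sum_range (K : ℕ) (q : ℕ → ℤ) :
    ∑ k ∈ range K, ∑ a ∈ range k, q a = ∑ a ∈ range K, ((K : ℤ) - 1 - a) * q a := by
  induction K with
  | zero => simp
  | succ K ih =>
    rw [sum_range_succ, sum_range_succ, ih, ← sum_add_distrib,
      show ((K + 1 : ℕ) : ℤ) - 1 - K = 0 by push_cast; ring, zero_mul, add_zero]
    refine sum_congr rfl fun a _ => ?_
    push_cast
    ring

open Finset in
theorem cost_swapped_eq
    (n : ℕ) (B M S ML0 : ℤ) (hB0 : 0 ≤ B)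
    (hM : (4 * (n : ℤ) + 8) * B < M) (hSB : S ≤ (n + 1) * (2 * B))
    (hML0 : ML0 = (n + 1) * M - 2 * S - 2 * B) (p y q : ℕ → ℤ)
    (hS : S = ∑ i ∈ range (n + 1), p i)
    (hy0 : y 0 = 0) (hyn : y (n + 1) = 0) (hyB : ∑ i ∈ range (n + 1), y i = B)
    (hq : ∀ a, 0 ≤ q a) (hq1 : ∀ a ≤ n, q a = p a + y (a + 1))
    (hq2 : ∀ i ≤ n, q (2 * n + 1 - i) = p i - y i)
    (P c : ℕ → ℤ) (hP : ∀ k, P k = ∑ a ∈ range k, q a)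
    (hc : ∀ k, c k = P k + max 0 (k * M - 2 * P k - ML0)) :
    ∑ k ∈ range (2 * n + 2), c (k + 1) + c (n + 1) + (n + 2) * (M - 2 * B) =
      ∑ j ∈ range (n + 1), (2 * ((n : ℤ) - j) + 1) * p j + S + (n + 2) * M
      + M * ∑ j ∈ range (n + 1), ((j : ℤ) + 1) + B := by
  have hstep : ∀ k, P (k + 1) = P k + q k := fun k => by rw [hP, hP, sum_range_succ]
  have hmono : Monotone P := monotone_nat_of_le_succ fun k => by linarith [hstep k, hq k]
  have hP0 : ∀ k, 0 ≤ P k := fun k => by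
    rw [hP]
    exact sum_nonneg fun a _ => hq a
  have hyB' : ∑ a ∈ range (n + 1), y (a + 1) = B := by
    have h := sum_range_succ y (n + 1)
    rw [sum_range_succ', hy0, hyn, hyB] at h
    linarith
  have hPn : P (n + 1) = S + B := by
    rw [hP, sum_congr rfl fun a ha => hq1 a (by simpa [Nat.lt_succ_iff] using ha),
      sum_add_distrib, hyB', hS]
  have htail : ∀ s ≤ n + 1, P (2 * n + 2 - s) = P (2 * n + 2) - ∑ i ∈ range s, (p i - y i) := by
    intro s hs
    induction s with
    | zero => simp
    | succ s ih =>
      have h := hstep (2 * n + 1 - s)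
      rw [show 2 * n + 1 - s + 1 = 2 * n + 2 - s by omega, ih (by omega),
        hq2 s (by omega)] at h
      rw [sum_range_succ, show 2 * n + 2 - (s + 1) = 2 * n + 1 - s by omega]
      linarith
  have hP2 : P (2 * n + 2) = 2 * S := by
    have h := htail (n + 1) le_rfl
    rw [show 2 * n + 2 - (n + 1) = n + 1 by omega, hPn, sum_sub_distrib, ← hS, hyB] at h
    linarith
  have hfirst : ∑ k ∈ range (n + 1), c (k + 1) =
      ∑ a ∈ range (n + 1), ((n : ℤ) + 1 - a) * (p a + y (a + 1)) := by
    have h1 : ∀ k ∈ range (n + 1), c (k + 1) = ∑ a ∈ range k, q a + q k := fun k hk => by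
      have hk' : k ≤ n := by simpa [Nat.lt_succ_iff] using hk
      rw [hc, max_eq_left, hstep, hP, add_zero]
      rw [hML0]
      rcases hk'.eq_or_lt with rfl | h
      · rw [hPn]
        push_cast
        linarith
      · obtain ⟨t, rfl⟩ : ∃ t, n = k + 1 + t := ⟨n - (k + 1), by omega⟩
        have h1 := hP0 (k + 1)
        have h2 := mul_nonneg (Int.natCast_nonneg k) hB0
        have h3 := mul_nonneg (Int.natCast_nonneg t) hB0
        have h4 : 0 ≤ (t : ℤ) * M := by
          push_cast at hM
          exact mul_nonneg (Int.natCast_nonneg t) (by linarith)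
        push_cast at *
        linarith
    rw [sum_congr rfl h1, sum_add_distrib, sum_range_sum_range, ← sum_add_distrib]
    refine sum_congr rfl fun a ha => ?_
    rw [hq1 a (by simpa [Nat.lt_succ_iff] using ha)]
    push_cast
    ring
  have hsecond : ∑ k ∈ range (n + 1), c (n + 1 + k + 1) =
      M * ∑ j ∈ range (n + 1), ((j : ℤ) + 1) + 2 * B * (n + 1)
        + ∑ a ∈ range (n + 1), ((n : ℤ) - a) * (p a - y a) := by
    have h1 : ∀ k ∈ range (n + 1), c (n + 1 + k + 1) = M * ((k : ℤ) + 1) + 2 * B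
        + ∑ i ∈ range (n + 1 - 1 - k), (p i - y i) := fun k hk => by
      have hk' : k ≤ n := by simpa [Nat.lt_succ_iff] using hk
      have h2 := htail (n - k) (by omega)
      have h3 := hmono (show n + 1 + k + 1 ≤ 2 * n + 2 by omega)
      rw [show 2 * n + 2 - (n - k) = n + 1 + k + 1 by omega, hP2] at h2
      rw [hc, max_eq_right, hML0, Nat.add_sub_cancel]
      · push_cast
        linarith
      · have h4 := mul_nonneg (Int.natCast_nonneg n) hB0
        have h5 : 0 ≤ (k : ℤ) * M := mul_nonneg (Int.natCast_nonneg k) (by linarith)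
        push_cast
        linarith
    rw [sum_congr rfl h1, sum_add_distrib, sum_add_distrib, ← mul_sum,
      sum_range_reflect (fun s => ∑ i ∈ range s, (p i - y i)), sum_range_sum_range]
    simp
    ring
  have hshift : ∑ a ∈ range (n + 1), ((n : ℤ) + 1 - a) * y (a + 1) =
      ∑ a ∈ range (n + 1), ((n : ℤ) + 2 - a) * y a := by
    have h := sum_range_succ (fun a => ((n : ℤ) + 2 - a) * y a) (n + 1)
    rw [sum_range_succ', hy0, hyn] at h
    simp only [mul_zero, add_zero] at h
    rw [← h]
    refine sum_congr rfl fun a _ => ?_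
    push_cast
    ring
  have hcn : c (n + 1) = S + B := by
    rw [hc, hML0, hPn, max_eq_left, add_zero]
    push_cast
    linarith
  have hcomb : ∑ a ∈ range (n + 1), ((n : ℤ) + 1 - a) * (p a + y (a + 1))
      + ∑ a ∈ range (n + 1), ((n : ℤ) - a) * (p a - y a) =
      ∑ j ∈ range (n + 1), (2 * ((n : ℤ) - j) + 1) * p j + 2 * B := by
    simp only [mul_add ((n : ℤ) + 1 - _), sum_add_distrib]
    rw [hshift, ← hyB, mul_sum, ← sum_add_distrib, ← sum_add_distrib, ← sum_add_distrib]
    exact sum_congr rfl fun a _ => by ring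
  rw [sum_range_succ_mul_two, hfirst, hsecond, hcn]
  linarith

/-- The canonical schedule (a job of each of the classes `0, …, n`, then the long job, then the
classes `n, …, 0`), with jobs `i - 1` and `n + 1 + i` interchanged for each `i ∈ X`. -/
def swappedOrder (n : ℕ) (X : Finset ℕ) (a : ℕ) : ℕ :=
  if a ≤ n then (if a + 1 ∈ X then n + 2 + a else a)
  else if a = n + 1 then 2 * n + 2
  else if 2 * n + 2 - a ∈ X then 2 * n + 2 - a - 1 else n + 1 + (2 * n + 2 - a)

theorem swappedOrder_lt {n : ℕ} (X : Finset ℕ) {a : ℕ} (ha : a < 2 * n + 3) :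
    swappedOrder n X a < 2 * n + 3 := by
  unfold swappedOrder
  split_ifs <;> omega

theorem swappedOrder_injOn {n : ℕ} {X : Finset ℕ} (hX : X ⊆ Finset.Icc 1 n) {a b : ℕ}
    (ha : a < 2 * n + 3) (hb : b < 2 * n + 3) (h : swappedOrder n X a = swappedOrder n X b) :
    a = b := by
  have hX' : ∀ i ∈ X, 1 ≤ i ∧ i ≤ n := fun i hi => Finset.mem_Icc.1 (hX hi)
  unfold swappedOrder at h
  grind

theorem exists_perm_restOrder_eq {n : ℕ} {X : Finset ℕ} (hX : X ⊆ Finset.Icc 1 n) :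
    ∃ (π : Equiv.Perm (Fin (2 * n + 3))) (m : Fin (2 * n + 3)), (m : ℕ) = n + 1 ∧
      (π m : ℕ) = 2 * n + 2 ∧ (∀ a ≤ n, restOrder π m a = swappedOrder n X a) ∧
      ∀ i ≤ n, restOrder π m (2 * n + 1 - i) = swappedOrder n X (2 * n + 2 - i) := by
  let f : Fin (2 * n + 3) → Fin (2 * n + 3) := fun a =>
    ⟨swappedOrder n X a, swappedOrder_lt X a.2⟩
  have hf : Function.Injective f := fun a b h =>
    Fin.ext (swappedOrder_injOn hX a.2 b.2 (Fin.val_eq_of_eq h))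
  refine ⟨Equiv.ofBijective f (Finite.injective_iff_bijective.1 hf), ⟨n + 1, by omega⟩, rfl,
    by simp [f, swappedOrder], fun a ha => ?_, fun i hi => ?_⟩
  · have h : a < 2 * n + 2 := by omega
    rw [restOrder, dif_pos h, Fin.succAbove_of_castSucc_lt _ _ (by simp [Fin.lt_def]; omega)]
    rfl
  · have h : 2 * n + 1 - i < 2 * n + 2 := by omega
    rw [restOrder, dif_pos h, Fin.succAbove_of_le_castSucc _ _ (by simp [Fin.le_def]; omega)]
    simp only [f, Equiv.ofBijective_apply, Fin.val_succ]
    congr 1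
    omega

/-- correctness of the reduction from Partition to `(1 | pMA | Σ C_i)`:
there is a subset `X₁ ⊆ {1,…,n}` with `Σ_{i ∈ X₁} x_i = B` if and only if there is a
schedule of the `2n+3` jobs of instance `I` with total completion time at most
`Q0 + B`. -/
theorem stmt11
    (n : ℕ) (x : ℕ → ℤ) (B M : ℤ)
    (hx : ∀ i, 1 ≤ i → i ≤ n → 0 < x i)
    (hB : ∑ i ∈ Finset.Icc 1 n, x i = 2 * B)
    (hM : (4 * (n : ℤ) + 8) * B < M)
    (p δ : ℕ → ℤ)
    (hp : ∀ i ≤ n, p i = ∑ j ∈ Finset.Icc 1 i, x j)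
    (hp' : ∀ i ≤ n, p (n + 1 + i) = p i)
    (hplast : p (2 * n + 2) = M - 2 * B)
    (hδ : ∀ i ≤ n, δ i = M - 2 * p i)
    (hδ' : ∀ i ≤ n, δ (n + 1 + i) = δ i)
    (hδlast : δ (2 * n + 2) = 0)
    (ML0 : ℤ) (hML0 : ML0 = (∑ i ∈ Finset.range (n + 1), δ i) - 2 * B)
    (Q0 : ℤ)
    (hQ0 : Q0 = (∑ j ∈ Finset.range (n + 1), ((n : ℤ) - (j : ℤ) + 1) * p j)
      + ((n : ℤ) + 2) * ((∑ j ∈ Finset.range (n + 1), p j) + 2 * B + p (2 * n + 2))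
      + (∑ j ∈ Finset.range (n + 1), ((j : ℤ) + 1) * (p j + δ j)))
    :
    (∃ X₁ : Finset ℕ, X₁ ⊆ Finset.Icc 1 n ∧ ∑ i ∈ X₁, x i = B) ↔
    (∃ π : Equiv.Perm (Fin (2 * n + 3)),
      totalCompl (2 * n + 3) p δ ML0 π ≤ Q0 + B) := by
  have hLast : ∀ π : Equiv.Perm (Fin (2 * n + 3)), ∀ m, (π m : ℕ) = 2 * n + 2 →
      δ (π m) = 0 := fun π m h => by rw [h, hδlast]
  have hδp : ∀ b < 2 * n + 2, δ b = M - 2 * p b := fun b hb => by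
    by_cases h : b ≤ n
    · exact hδ b h
    · obtain ⟨i, rfl⟩ : ∃ i, b = n + 1 + i := ⟨b - (n + 1), by omega⟩
      rw [hδ' i (by omega), hp' i (by omega), hδ i (by omega)]
  have hδsum : ∑ i ∈ Finset.range (n + 1), δ i =
      (n + 1) * M - 2 * ∑ i ∈ Finset.range (n + 1), p i := by
    rw [Finset.sum_congr rfl fun i hi => hδp i (by rw [Finset.mem_range] at hi; omega),
      Finset.sum_sub_distrib, ← Finset.mul_sum]
    simp
  have hQ : Q0 = ∑ j ∈ Finset.range (n + 1), (2 * ((n : ℤ) - j) + 1) * p j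
      + ∑ i ∈ Finset.range (n + 1), p i + (n + 2) * M
      + M * ∑ j ∈ Finset.range (n + 1), ((j : ℤ) + 1) := by
    rw [hQ0, hplast, show ∀ s : ℤ, ((n : ℤ) + 2) * (s + 2 * B + (M - 2 * B)) =
      ((n : ℤ) + 1) * s + s + (n + 2) * M from fun s => by ring]
    have h : ∀ j ∈ Finset.range (n + 1), ((j : ℤ) + 1) * (p j + δ j) =
        M * ((j : ℤ) + 1) - ((j : ℤ) + 1) * p j := fun j hj => by
      rw [hδp j (by rw [Finset.mem_range] at hj; omega)]
      ring
    have h' : ∑ j ∈ Finset.range (n + 1), (2 * ((n : ℤ) - j) + 1) * p j =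
        ∑ j ∈ Finset.range (n + 1), ((n : ℤ) - j + 1) * p j
        + (n + 1) * ∑ j ∈ Finset.range (n + 1), p j
        - ∑ j ∈ Finset.range (n + 1), ((j : ℤ) + 1) * p j := by
      rw [Finset.mul_sum, ← Finset.sum_add_distrib, ← Finset.sum_sub_distrib]
      exact Finset.sum_congr rfl fun j _ => by ring
    rw [Finset.sum_congr rfl h, Finset.sum_sub_distrib, ← Finset.mul_sum, h']
    ring
  rw [hδsum] at hML0
  have hcost : ∀ (π : Equiv.Perm (Fin (2 * n + 3))) (m : Fin (2 * n + 3)),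
      (π m : ℕ) = 2 * n + 2 → ∀ P c : ℕ → ℤ,
      (∀ k, P k = ∑ a ∈ Finset.range k, p (restOrder π m a)) →
      (∀ k, c k = P k + max 0 (k * M - 2 * P k - ML0)) →
      totalCompl (2 * n + 3) p δ ML0 π = ∑ k ∈ Finset.range (2 * n + 2), c (k + 1) + c m
        + (2 * n + 3 - (m : ℕ)) * (M - 2 * B) := fun π m hm P c hP hc => by
    rw [totalCompl_eq p δ ML0 π m (hLast π m hm) c fun k _ => ?_, hm, hplast]
    · push_cast
      ring
    · rw [hc, hP, Finset.sum_congr rfl fun a _ =>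
        hδp _ (restOrder_lt (by omega) π m hm a), Finset.sum_sub_distrib, ← Finset.mul_sum]
      simp
  constructor
  · rintro ⟨X, hX, hXB⟩
    have hX' : ∀ i ∈ X, 1 ≤ i ∧ i ≤ n := fun i hi => Finset.mem_Icc.1 (hX hi)
    obtain ⟨π, m, hmn, hm, hrest1, hrest2⟩ := exists_perm_restOrder_eq hX
    refine ⟨π, ?_⟩
    let y : ℕ → ℤ := fun i => if i ∈ X then x i else 0
    have hpsucc : ∀ i < n, p (i + 1) = p i + x (i + 1) := fun i hi => by
      rw [hp _ hi, hp i hi.le, Finset.sum_Icc_succ_top (by omega)]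
    have hpos : ∀ b < 2 * n + 2, 0 ≤ p b ∧ p b ≤ 2 * B := fun b hb =>
      prefix_sum_bounds hx hB hp hp' hb
    have hSB := sum_prefix_sum_le fun b hb => (hpos b hb).2
    have hyB : ∑ i ∈ Finset.range (n + 1), y i = B := by
      simp only [y]
      rw [← Finset.sum_filter, ← hXB]
      congr 1
      ext i
      simp only [Finset.mem_filter, Finset.mem_range]
      exact ⟨fun h => h.2, fun h => ⟨by have := hX' i h; omega, h⟩⟩
    have hB0 : 0 ≤ B := by linarith [hpos 0 (by omega)]
    rw [hcost π m hm _ _ (fun _ => rfl) (fun _ => rfl), hQ,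
      ← cost_swapped_eq n B M _ ML0 hB0 hM hSB hML0 p y (fun a => p (restOrder π m a)) rfl
        (if_neg fun h => by have := hX' _ h; omega) (if_neg fun h => by have := hX' _ h; omega)
        hyB (fun a => (hpos _ (restOrder_lt (by omega) π m hm a)).1) ?_ ?_ _ _
        (fun _ => rfl) (fun _ => rfl)]
    · rw [hmn]
      push_cast
      linarith
    · intro a ha
      simp only [hrest1 a ha, swappedOrder, if_pos ha, y]
      split_ifs with h
      · have := hX' _ h
        rw [show n + 2 + a = n + 1 + (a + 1) by ring, hp' _ this.2, hpsucc a this.2]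
      · rw [add_zero]
    · intro i hi
      simp only [hrest2 i hi, swappedOrder, y]
      rw [if_neg (by omega), if_neg (by omega), show 2 * n + 2 - (2 * n + 2 - i) = i by omega]
      split_ifs with h
      · obtain ⟨j, rfl⟩ : ∃ j, i = j + 1 := ⟨i - 1, by have := hX' _ h; omega⟩
        rw [hpsucc j hi, Nat.add_sub_cancel, add_sub_cancel_right]
      · rw [hp' i hi, sub_zero]
  · rintro ⟨π, hπ⟩
    let m := π.symm (Fin.last (2 * n + 2))
    have hm : (π m : ℕ) = 2 * n + 2 := by simp [m]
    rw [hcost π m hm _ _ (fun _ => rfl) (fun _ => rfl)] at hπ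
    exact exists_subset_of_cost_le n x B M hx hB hM p hp hp' _ ML0 rfl hML0 Q0 hQ
      (restOrder π m) (restOrder_lt (by omega) π m hm) (sum_restOrder π m hm) _ _
      (fun _ => rfl) (fun _ => rfl) m hπ
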